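/- There exist constants K, L, υ3, υ4 > 0 such that for every integer n ≥ 1, L e^{−υ3 n^γ} ≤ ν((0, y_n]) ≤ K e^{−υ4 n^γ}, where y_n is defined by y_0 = 1/2 and y_{n+1} ∈ (0, 1/2] is the unique point with T(y_{n+1}) = y_n. -/

import Mathlib

open MeasureTheory Set

/-- The interval map `T` of the example: `T(x) = x (1 + c / |log x|^β)` on `(0, 1/2]`
with `β = 1/γ - 1`, `c = (log 2)^β`, `T(x) = 2x - 1` on `(1/2, 1]`, and `T(0) = 0`. -/
noncomputable def Tmap (γ : ℝ) (x : ℝ) : ℝ :=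
  if x ≤ 0 then 0
  else if x ≤ 1 / 2 then x * (1 + (Real.log 2) ^ (1 / γ - 1) / |Real.log x| ^ (1 / γ - 1))
  else 2 * x - 1


/-- Inverse branches of order `k`. -/
noncomputable def br (p : ℝ → ℝ) : ℕ → List (ℝ → ℝ)
  | 0 => [id]
  | k + 1 => (br p k).map (fun φ x => p (φ x)) ++ (br p k).map (fun φ x => (1 + φ x) / 2)

lemma br_succ_mem {p : ℝ → ℝ} {k : ℕ} {φ : ℝ → ℝ} (h : φ ∈ br p (k + 1)) :
    ∃ χ ∈ br p k, φ = (fun x => p (χ x)) ∨ φ = (fun x => (1 + χ x) / 2) := by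
  simp only [br, List.mem_append, List.mem_map] at h
  rcases h with ⟨χ, h1, h2⟩ | ⟨χ, h1, h2⟩
  · exact ⟨χ, h1, Or.inl h2.symm⟩
  · exact ⟨χ, h1, Or.inr h2.symm⟩

lemma br_props {p : ℝ → ℝ} (hp : ConcaveOn ℝ (Icc 0 1) p) (hm : MonotoneOn p (Icc 0 1))
    (hmaps : MapsTo p (Icc 0 1) (Icc 0 1)) (k : ℕ) :
    ∀ φ ∈ br p k, ConcaveOn ℝ (Icc 0 1) φ ∧ MonotoneOn φ (Icc 0 1) ∧
      MapsTo φ (Icc 0 1) (Icc 0 1) := by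
  induction k with
  | zero =>
    intro φ h
    simp only [br, List.mem_singleton] at h
    subst h
    exact ⟨concaveOn_id (convex_Icc 0 1), monotoneOn_id, mapsTo_id _⟩
  | succ k ih =>
    intro φ h
    obtain ⟨χ, hχ, h | h⟩ := br_succ_mem h
    · obtain ⟨h1, h2, h3⟩ := ih χ hχ
      subst h
      refine ⟨⟨convex_Icc 0 1, ?_⟩, ?_, fun x hx => hmaps (h3 hx)⟩
      · intro x hx y hy a b ha hb hab
        have hxy := convex_Icc (0:ℝ) 1 hx hy ha hb hab
        have hxy' := convex_Icc (0:ℝ) 1 (h3 hx) (h3 hy) ha hb hab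
        exact (hp.2 (h3 hx) (h3 hy) ha hb hab).trans
          (hm hxy' (h3 hxy) (h1.2 hx hy ha hb hab))
      · intro x hx y hy hxy
        exact hm (h3 hx) (h3 hy) (h2 hx hy hxy)
    · obtain ⟨h1, h2, h3⟩ := ih χ hχ
      subst h
      refine ⟨⟨convex_Icc 0 1, ?_⟩, ?_, ?_⟩
      · intro x hx y hy a b ha hb hab
        have := h1.2 hx hy ha hb hab
        simp only [smul_eq_mul] at this ⊢
        nlinarith
      · intro x hx y hy hxy
        have := h2 hx hy hxy
        simp only; linarith
      · intro x hx
        have := h3 hx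
        simp only [mem_Icc] at this ⊢
        constructor <;> linarith

lemma br_sum_inv {p : ℝ → ℝ} {G : ℝ → ℝ}
    (hG : ∀ x ∈ Icc (0:ℝ) 1, G x = (G (p x)) + (G ((1 + x) / 2) - G (1 / 2)))
    (hG0 : G 0 = 0) (k : ℕ) (hk : ∀ k, ∀ φ ∈ br p k, MapsTo φ (Icc 0 1) (Icc 0 1))
    (x : ℝ) (hx : x ∈ Icc (0:ℝ) 1) :
    ((br p k).map (fun φ => G (φ x) - G (φ 0))).sum = G x := by
  induction k with
  | zero => simp [br, hG0]
  | succ k ih =>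
    have hk' := hk k
    rw [← ih]
    simp only [br, List.map_append, List.sum_append, List.map_map]
    rw [← List.sum_map_add]
    congr 1
    apply List.map_congr_left
    intro φ hφ
    have e1 := hG _ (hk' φ hφ hx)
    have e2 := hG _ (hk' φ hφ (left_mem_Icc.2 zero_le_one))
    simp only [Function.comp]
    linarith

lemma br_sum_tel {p : ℝ → ℝ} (hp0 : p 0 = 0) (hp1 : p 1 = 1 / 2) (k : ℕ) :
    ∀ F : ℝ → ℝ, ((br p k).map (fun φ => F (φ 1) - F (φ 0))).sum = F 1 - F 0 := by
  induction k with
  | zero => simp [br]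
  | succ k ih =>
    intro F
    simp only [br, List.map_append, List.sum_append, List.map_map]
    have e1 := ih (fun x => F (p x))
    have e2 := ih (fun x => F ((1 + x) / 2))
    simp only [Function.comp_def]
    rw [e1, e2, hp0, hp1]
    norm_num

lemma br_mesh {p : ℝ → ℝ}
    (hprop : ∀ k, ∀ φ ∈ br p k, MonotoneOn φ (Icc 0 1) ∧ MapsTo φ (Icc 0 1) (Icc 0 1))
    (hexp : ∀ δ : ℝ, 0 < δ → ∃ η : ℝ, 0 < η ∧ η ≤ 1 ∧ ∀ a b : ℝ, 0 ≤ a → a ≤ b → b ≤ 1 →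
      δ ≤ p b - p a → (1 + η) * (p b - p a) ≤ b - a) (δ : ℝ) (hδ : 0 < δ) :
    ∃ k, ∀ φ ∈ br p k, φ 1 - φ 0 < δ := by
  obtain ⟨η, h0, h1, h⟩ := hexp δ hδ
  have key : ∀ k, ∀ φ ∈ br p k, ∀ δ' , δ ≤ δ' → δ' ≤ φ 1 - φ 0 → (1 + η) ^ k * δ' ≤ 1 := by
    intro k
    induction k with
    | zero =>
      intro φ hφ δ' _ h2
      simp only [br, List.mem_singleton] at hφ
      subst hφ
      simpa using h2
    | succ k ih =>
      intro φ hφ δ' h2 h3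
      obtain ⟨χ, hχ, e | e⟩ := br_succ_mem hφ
      all_goals
        subst e
        obtain ⟨m1, m2⟩ := hprop k χ hχ
        have z0 : (0:ℝ) ∈ Icc (0:ℝ) 1 := by simp
        have z1 : (1:ℝ) ∈ Icc (0:ℝ) 1 := by simp
        have a0 := m2 z0
        have a1 := m2 z1
        have a2 := m1 z0 z1 zero_le_one
        simp only at h3
        rw [pow_succ, mul_assoc]
        apply ih χ hχ ((1 + η) * δ')
        · nlinarith
      · have := h _ _ a0.1 a2 a1.2 (h2.trans h3)
        nlinarith
      · nlinarith
  obtain ⟨k, hk⟩ := pow_unbounded_of_one_lt (1 / δ) (show 1 < 1 + η by linarith)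
  refine ⟨k, fun φ hφ => ?_⟩
  by_contra! hc
  have := key k φ hφ δ le_rfl hc
  rw [div_lt_iff₀ hδ] at hk
  linarith

lemma concave_of_inv {p : ℝ → ℝ} {G : ℝ → ℝ} {h : ℝ → ℝ}
    (hp : ConcaveOn ℝ (Icc 0 1) p) (hm : MonotoneOn p (Icc 0 1))
    (hmaps : MapsTo p (Icc 0 1) (Icc 0 1))
    (hp0 : p 0 = 0) (hp1 : p 1 = 1 / 2)
    (hexp : ∀ δ : ℝ, 0 < δ → ∃ η : ℝ, 0 < η ∧ η ≤ 1 ∧ ∀ a b : ℝ, 0 ≤ a → a ≤ b → b ≤ 1 →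
      δ ≤ p b - p a → (1 + η) * (p b - p a) ≤ b - a)
    (hG : ∀ x ∈ Icc (0:ℝ) 1, G x = (G (p x)) + (G ((1 + x) / 2) - G (1 / 2)))
    (hG0 : G 0 = 0) (hInt : Integrable h) (hnn : ∀ x, 0 ≤ h x)
    (hGh : ∀ x ∈ Icc (0:ℝ) 1, G x = ∫ t in (0:ℝ)..x, h t) :
    ConcaveOn ℝ (Icc 0 1) G := by
  have hpr := br_props hp hm hmaps
  have approx : ∀ ε : ℝ, 0 < ε → ∃ F : ℝ → ℝ, ConcaveOn ℝ (Icc 0 1) F ∧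
      ∀ x ∈ Icc (0:ℝ) 1, |G x - F x| ≤ 2 * ε := by
    intro ε hε
    obtain ⟨g, hgs, hgle, hgc, hgi⟩ := hInt.exists_hasCompactSupport_integral_sub_le hε
    have huc := hgc.uniformContinuous_of_tendsto_cocompact hgs.is_zero_at_infty
    rw [Metric.uniformContinuous_iff] at huc
    obtain ⟨δ, hδ, hu⟩ := huc ε hε
    obtain ⟨k, hk⟩ := br_mesh (fun k φ hφ => (hpr k φ hφ).2) hexp δ hδ
    let F : ℝ → ℝ := fun x => ((br p k).map (fun φ => max (g (φ 0)) 0 * (φ x - φ 0))).sum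
    let H : ℝ → ℝ := fun x => (∫ t in (0:ℝ)..x, |h t - g t|) + ε * x
    have hdi : Integrable (fun t => |h t - g t|) := (hInt.sub hgi).abs
    have hH1 : H 1 - H 0 ≤ 2 * ε := by
      have : (∫ t in (0:ℝ)..1, |h t - g t|) ≤ ∫ t, |h t - g t| := by
        rw [intervalIntegral.integral_of_le zero_le_one]
        exact setIntegral_le_integral hdi (Filter.Eventually.of_forall fun t => abs_nonneg _)
      simp only [Real.norm_eq_abs] at hgle
      simp only [H, intervalIntegral.integral_same]
      linarith
    refine ⟨F, ?_, ?_⟩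
    · have : ∀ l : List (ℝ → ℝ), (∀ φ ∈ l, ConcaveOn ℝ (Icc (0:ℝ) 1) φ) →
          ConcaveOn ℝ (Icc (0:ℝ) 1)
            (fun x => (l.map (fun φ => max (g (φ 0)) 0 * (φ x - φ 0))).sum) := by
        intro l
        induction l with
        | nil => intro _; simpa using concaveOn_const (0:ℝ) (convex_Icc (0:ℝ) 1)
        | cons φ l ih =>
          intro hl
          simp only [List.map_cons, List.sum_cons]
          refine ConcaveOn.add ?_ (ih fun χ hχ => hl χ (List.mem_cons_of_mem _ hχ))
          have h1 := hl φ List.mem_cons_self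
          have := (h1.add (concaveOn_const (-φ 0) (convex_Icc (0:ℝ) 1))).smul
            (le_max_right (g (φ 0)) 0)
          simpa [sub_eq_add_neg] using this
      exact this _ fun φ hφ => (hpr k φ hφ).1
    · intro x hx
      have e1 := br_sum_inv hG hG0 k (fun k φ hφ => (hpr k φ hφ).2.2) x hx
      have e2 := br_sum_tel hp0 hp1 k H
      have z0 : (0:ℝ) ∈ Icc (0:ℝ) 1 := by simp
      have z1 : (1:ℝ) ∈ Icc (0:ℝ) 1 := by simp
      have term : ∀ φ ∈ br p k,
          |(G (φ x) - G (φ 0)) - max (g (φ 0)) 0 * (φ x - φ 0)| ≤ H (φ 1) - H (φ 0) := by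
        intro φ hφ
        obtain ⟨-, m1, m2⟩ := hpr k φ hφ
        have i0 := m1 z0 hx hx.1
        have i1 := m1 hx z1 hx.2
        have ii : ∀ a b, IntervalIntegrable h volume a b := fun a b => hInt.intervalIntegrable
        have ij : ∀ a b, IntervalIntegrable (fun t => |h t - g t|) volume a b :=
          fun a b => hdi.intervalIntegrable
        have E1 : G (φ x) - G (φ 0) = ∫ t in (φ 0)..(φ x), h t := by
          rw [hGh _ (m2 hx), hGh _ (m2 z0), intervalIntegral.integral_interval_sub_left (ii _ _) (ii _ _)]
        have E2 : max (g (φ 0)) 0 * (φ x - φ 0) = ∫ t in (φ 0)..(φ x), max (g (φ 0)) 0 := by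
          simp [mul_comm]
        have E3 : H (φ 1) - H (φ 0) = ∫ t in (φ 0)..(φ 1), (|h t - g t| + ε) := by
          rw [intervalIntegral.integral_add (ij _ _) (by simp)]
          simp only [H]
          have := intervalIntegral.integral_interval_sub_left (ij 0 (φ 1)) (ij 0 (φ 0))
          rw [← this]
          simp only [intervalIntegral.integral_const, smul_eq_mul]
          ring
        have ik : ∀ a b, IntervalIntegrable (fun t => |h t - g t| + ε) volume a b :=
          fun a b => (ij a b).add (by simp)
        rw [E1, E2, E3, ← intervalIntegral.integral_sub (ii _ _) (by simp)]
        calc |∫ t in (φ 0)..(φ x), (h t - max (g (φ 0)) 0)|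
            ≤ ∫ t in (φ 0)..(φ x), |h t - max (g (φ 0)) 0| :=
              intervalIntegral.abs_integral_le_integral_abs i0
          _ ≤ ∫ t in (φ 0)..(φ x), (|h t - g t| + ε) := by
              apply intervalIntegral.integral_mono_on i0 ((ii _ _).sub (by simp)).abs (ik _ _)
              intro t ht
              have d : dist t (φ 0) < δ := by
                rw [Real.dist_eq, abs_of_nonneg (by linarith [ht.1])]
                have := hk φ hφ
                linarith [ht.2]
              have d1 := hu d
              rw [Real.dist_eq] at d1
              have d2 : |h t - max (g (φ 0)) 0| ≤ |h t - g (φ 0)| := by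
                have := abs_max_sub_max_le_abs (h t) (g (φ 0)) 0
                rwa [max_eq_left (hnn t)] at this
              have d3 := abs_sub_le (h t) (g t) (g (φ 0))
              linarith
          _ ≤ ∫ t in (φ 0)..(φ 1), (|h t - g t| + ε) := by
              apply intervalIntegral.integral_mono_interval le_rfl i0 i1 _ (ik _ _)
              exact Filter.Eventually.of_forall fun t => by
                simp only [Pi.zero_apply]; positivity
      have gen : ∀ l : List (ℝ → ℝ), (∀ φ ∈ l,
          |(G (φ x) - G (φ 0)) - max (g (φ 0)) 0 * (φ x - φ 0)| ≤ H (φ 1) - H (φ 0)) →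
          |(l.map (fun φ => G (φ x) - G (φ 0))).sum -
            (l.map (fun φ => max (g (φ 0)) 0 * (φ x - φ 0))).sum| ≤
            (l.map (fun φ => H (φ 1) - H (φ 0))).sum := by
        intro l
        induction l with
        | nil => simp
        | cons φ l ih =>
          intro hl
          have h1 := hl φ List.mem_cons_self
          have h2 := ih fun χ hχ => hl χ (List.mem_cons_of_mem _ hχ)
          simp only [List.map_cons, List.sum_cons]
          rw [abs_le] at *
          constructor <;> linarith [h1.1, h1.2, h2.1, h2.2]
      have := gen _ term
      rw [e1, e2] at this
      exact this.trans hH1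
  refine ⟨convex_Icc 0 1, fun x hx y hy a b ha hb hab => ?_⟩
  apply le_of_forall_pos_le_add
  intro ε hε
  obtain ⟨F, hF, hFG⟩ := approx (ε / 4) (by linarith)
  have h1 := abs_le.1 (hFG x hx)
  have h2 := abs_le.1 (hFG y hy)
  have h3 := abs_le.1 (hFG _ (convex_Icc (0:ℝ) 1 hx hy ha hb hab))
  have h4 := hF.2 hx hy ha hb hab
  simp only [smul_eq_mul] at *
  have h5 : a * G x ≤ a * (F x + 2 * (ε / 4)) := by gcongr; linarith
  have h6 : b * G y ≤ b * (F y + 2 * (ε / 4)) := by gcongr; linarith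
  have h7 : a * (2 * (ε / 4)) + b * (2 * (ε / 4)) = 2 * (ε / 4) := by rw [← add_mul, hab, one_mul]
  nlinarith

noncomputable def qf (β x : ℝ) : ℝ := (Real.log 2) ^ β / |Real.log x| ^ β
noncomputable def T1 (β x : ℝ) : ℝ := x * (1 + qf β x)

lemma log2_le {x : ℝ} (h0 : 0 < x) (h : x ≤ 1 / 2) : Real.log 2 ≤ - Real.log x := by
  rw [← Real.log_inv]
  apply Real.log_le_log (by norm_num)
  rw [le_inv_comm₀ (by norm_num) h0]; linarith

lemma abs_log {x : ℝ} (h0 : 0 < x) (h : x ≤ 1) : |Real.log x| = - Real.log x :=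
  abs_of_nonpos (Real.log_nonpos h0.le h)

lemma log2_pos : 0 < Real.log 2 := Real.log_pos (by norm_num)

lemma qf_pos {β x : ℝ} (h0 : 0 < x) (h : x ≤ 1 / 2) : 0 < qf β x := by
  have := log2_pos
  have := log2_le h0 h
  have : 0 < |Real.log x| := by rw [abs_log h0 (by linarith)]; linarith
  unfold qf; positivity

lemma qf_mono {β x y : ℝ} (hβ : 0 ≤ β) (h0 : 0 < x) (hxy : x ≤ y) (h : y ≤ 1 / 2) :
    qf β x ≤ qf β y := by
  have h1 := log2_pos
  have h2 := log2_le (h0.trans_le hxy) h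
  unfold qf
  rw [abs_log h0 (by linarith), abs_log (h0.trans_le hxy) (by linarith)]
  have h3 := Real.log_le_log h0 hxy
  have : 0 < - Real.log y := by linarith
  gcongr

lemma qf_half {β : ℝ} : qf β (1 / 2) = 1 := by
  have h1 := log2_pos
  unfold qf
  rw [abs_log (by norm_num) (by norm_num), one_div, Real.log_inv, neg_neg, div_self]
  positivity

lemma qf_le_one {β x : ℝ} (hβ : 0 ≤ β) (h0 : 0 < x) (h : x ≤ 1 / 2) : qf β x ≤ 1 := by
  rw [← qf_half (β := β)]; exact qf_mono hβ h0 h le_rfl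

lemma T1_zero {β : ℝ} : T1 β 0 = 0 := by simp [T1]
lemma T1_half {β : ℝ} : T1 β (1 / 2) = 1 := by unfold T1; rw [qf_half]; norm_num

lemma T1_expand {β u v : ℝ} (hβ : 0 ≤ β) (h0 : 0 ≤ u) (huv : u ≤ v) (hv0 : 0 < v)
    (h : v ≤ 1 / 2) : (1 + qf β v) * (v - u) ≤ T1 β v - T1 β u := by
  unfold T1
  rcases h0.eq_or_lt with rfl | h0
  · simp [mul_comm]
  · have := qf_mono hβ h0 huv h
    nlinarith

lemma T1_strictMono {β : ℝ} (hβ : 0 ≤ β) : StrictMonoOn (T1 β) (Icc 0 (1 / 2)) := by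
  intro u hu v hv huv
  have hv0 : 0 < v := hu.1.trans_lt huv
  have := T1_expand hβ hu.1 huv.le hv0 hv.2
  have := qf_pos (β := β) hv0 hv.2
  nlinarith

lemma T1_hasDerivAt {β x : ℝ} (h0 : 0 < x) (h1 : x < 1) :
    HasDerivAt (T1 β) (1 + (Real.log 2) ^ β * (-Real.log x) ^ (-β) +
      (Real.log 2) ^ β * β * (-Real.log x) ^ (-β - 1)) x := by
  have hl : Real.log x < 0 := Real.log_neg h0 h1
  have e : T1 β =ᶠ[nhds x] fun x => x * (1 + (Real.log 2) ^ β * (-Real.log x) ^ (-β)) := by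
    filter_upwards [Ioo_mem_nhds h0 h1] with t ht
    unfold T1 qf
    rw [abs_log ht.1 ht.2.le, Real.rpow_neg (by linarith [Real.log_nonpos ht.1.le ht.2.le]),
      div_eq_mul_inv]
  refine HasDerivAt.congr_of_eventuallyEq ?_ e
  have d0 : HasDerivAt (fun x => -Real.log x) (-x⁻¹) x := (Real.hasDerivAt_log h0.ne').neg
  have d1 := d0.rpow_const (p := -β) (Or.inl (by linarith))
  have d2 := (hasDerivAt_id x).mul ((d1.const_mul ((Real.log 2) ^ β)).const_add 1)
  refine d2.congr_deriv ?_
  simp only [id]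
  field_simp

lemma T1_cont {β : ℝ} (hβ : 0 ≤ β) : ContinuousOn (T1 β) (Icc 0 (1 / 2)) := by
  intro x hx
  rcases hx.1.eq_or_lt with rfl | h0
  · unfold ContinuousWithinAt
    rw [T1_zero]
    refine tendsto_of_tendsto_of_tendsto_of_le_of_le' (g := fun _ => 0) (h := fun x => 2 * x)
      tendsto_const_nhds ?_ ?_ ?_
    · have : ContinuousWithinAt (fun x : ℝ => 2 * x) (Icc 0 (1 / 2)) 0 := by fun_prop
      simpa [ContinuousWithinAt] using this
    · filter_upwards [self_mem_nhdsWithin] with t ht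
      rw [← T1_zero (β := β)]
      exact (T1_strictMono hβ).monotoneOn hx ht ht.1
    · filter_upwards [self_mem_nhdsWithin] with t ht
      rcases ht.1.eq_or_lt with rfl | h0
      · simp [T1_zero]
      · have := qf_le_one hβ h0 ht.2
        unfold T1; nlinarith
  · exact (T1_hasDerivAt h0 (by linarith [hx.2])).continuousAt.continuousWithinAt

lemma T1_convex {β : ℝ} (hβ : 0 ≤ β) : ConvexOn ℝ (Icc 0 (1 / 2)) (T1 β) := by
  apply MonotoneOn.convexOn_of_deriv (convex_Icc _ _) (T1_cont hβ)
  · rw [interior_Icc]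
    intro x hx
    exact (T1_hasDerivAt hx.1 (by linarith [hx.2])).differentiableAt.differentiableWithinAt
  · rw [interior_Icc]
    intro x hx y hy hxy
    rw [(T1_hasDerivAt hx.1 (by linarith [hx.2])).deriv,
      (T1_hasDerivAt hy.1 (by linarith [hy.2])).deriv]
    have h1 := log2_pos
    have h2 : 0 < -Real.log y := by linarith [Real.log_neg hy.1 (by linarith [hy.2])]
    have h3 : -Real.log y ≤ -Real.log x := by linarith [Real.log_le_log hx.1 hxy]
    have h4 := Real.rpow_le_rpow_of_nonpos h2 h3 (show -β ≤ 0 by linarith)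
    have h5 := Real.rpow_le_rpow_of_nonpos h2 h3 (show -β - 1 ≤ 0 by linarith)
    gcongr

lemma exists_inv {β : ℝ} (hβ : 0 ≤ β) : ∃ p : ℝ → ℝ,
    ∀ x ∈ Icc (0:ℝ) 1, p x ∈ Icc (0:ℝ) (1 / 2) ∧ T1 β (p x) = x := by
  have h := intermediate_value_Icc (show (0:ℝ) ≤ 1 / 2 by norm_num) (T1_cont hβ)
  rw [T1_zero, T1_half] at h
  have : ∀ x, ∃ u, x ∈ Icc (0:ℝ) 1 → u ∈ Icc (0:ℝ) (1 / 2) ∧ T1 β u = x := by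
    intro x
    by_cases hx : x ∈ Icc (0:ℝ) 1
    · obtain ⟨u, hu, e⟩ := h hx
      exact ⟨u, fun _ => ⟨hu, e⟩⟩
    · exact ⟨0, fun h => absurd h hx⟩
  choose p hp using this
  exact ⟨p, hp⟩

lemma inv_props {β : ℝ} (hβ : 0 ≤ β) {p : ℝ → ℝ}
    (hp : ∀ x ∈ Icc (0:ℝ) 1, p x ∈ Icc (0:ℝ) (1 / 2) ∧ T1 β (p x) = x) :
    ConcaveOn ℝ (Icc 0 1) p ∧ MonotoneOn p (Icc 0 1) ∧ MapsTo p (Icc 0 1) (Icc 0 1) ∧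
    p 0 = 0 ∧ p 1 = 1 / 2 ∧
    (∀ δ : ℝ, 0 < δ → ∃ η : ℝ, 0 < η ∧ η ≤ 1 ∧ ∀ a b : ℝ, 0 ≤ a → a ≤ b → b ≤ 1 →
      δ ≤ p b - p a → (1 + η) * (p b - p a) ≤ b - a) := by
  have sm := T1_strictMono hβ
  have z0 : (0:ℝ) ∈ Icc (0:ℝ) (1 / 2) := by constructor <;> norm_num
  have z1 : (1 / 2:ℝ) ∈ Icc (0:ℝ) (1 / 2) := by constructor <;> norm_num
  have hmono : MonotoneOn p (Icc 0 1) := by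
    intro x hx y hy hxy
    rw [← sm.le_iff_le (hp x hx).1 (hp y hy).1, (hp x hx).2, (hp y hy).2]
    exact hxy
  refine ⟨⟨convex_Icc _ _, ?_⟩, hmono, ?_, ?_, ?_, ?_⟩
  · intro x hx y hy a b ha hb hab
    have hm := convex_Icc (0:ℝ) 1 hx hy ha hb hab
    have hm' := convex_Icc (0:ℝ) (1 / 2) (hp x hx).1 (hp y hy).1 ha hb hab
    rw [← sm.le_iff_le hm' (hp _ hm).1, (hp _ hm).2]
    have := (T1_convex hβ).2 (hp x hx).1 (hp y hy).1 ha hb hab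
    rwa [(hp x hx).2, (hp y hy).2] at this
  · intro x hx
    exact ⟨(hp x hx).1.1, by linarith [(hp x hx).1.2]⟩
  · have := hp 0 (by simp)
    exact sm.injOn this.1 z0 (by rw [this.2, T1_zero])
  · have := hp 1 (by simp)
    exact sm.injOn this.1 z1 (by rw [this.2, T1_half])
  · intro δ hδ
    by_cases hd : δ ≤ 1 / 2
    · refine ⟨qf β δ, qf_pos hδ hd, qf_le_one hβ hδ hd, ?_⟩
      intro a b ha hab hb h
      have hA := hp a ⟨ha, hab.trans hb⟩
      have hB := hp b ⟨ha.trans hab, hb⟩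
      have h1 := hA.1.1
      have h2 := hB.1.2
      have := T1_expand hβ h1 (by linarith) (by linarith) h2
      rw [hA.2, hB.2] at this
      have h3 := qf_mono hβ hδ (show δ ≤ p b by linarith) h2
      nlinarith
    · refine ⟨1, one_pos, le_rfl, ?_⟩
      intro a b ha hab hb h
      have hA := hp a ⟨ha, hab.trans hb⟩
      have hB := hp b ⟨ha.trans hab, hb⟩
      have h1 := hA.1.1
      have h2 := hB.1.2
      linarith

/-- Asymptotics of the sequence. -/
lemma seq_bounds {γ : ℝ} (hγ0 : 0 < γ) (hγ1 : γ ≤ 1) {y : ℕ → ℝ}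
    (hy : ∀ n, 0 < y n ∧ y n ≤ 1 / 2) (hr : ∀ n, T1 (1 / γ - 1) (y (n + 1)) = y n) :
    ∃ a b : ℝ, 0 < a ∧ 0 < b ∧ ∀ n : ℕ, 1 ≤ n →
      Real.exp (-b * (n:ℝ) ^ γ) ≤ y n ∧ y n ≤ Real.exp (-a * (n:ℝ) ^ γ) := by
  set β := 1 / γ - 1 with hβd
  have hp1 : 1 ≤ 1 / γ := by rw [le_div_iff₀ hγ0]; linarith
  have hβ : 0 ≤ β := by linarith
  set c := (Real.log 2) ^ β with hc
  have l2 := log2_pos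
  have c0 : 0 < c := by positivity
  let l : ℕ → ℝ := fun n => - Real.log (y n)
  have hl : ∀ n, Real.log 2 ≤ l n := fun n => log2_le (hy n).1 (hy n).2
  have hl0 : ∀ n, 0 < l n := fun n => l2.trans_le (hl n)
  have hq : ∀ n, qf β (y n) * (l n) ^ β = c := by
    intro n
    have : 0 < (l n) ^ β := Real.rpow_pos_of_pos (hl0 n) _
    unfold qf
    rw [abs_log (hy n).1 (by linarith [(hy n).2])]
    exact div_mul_cancel₀ _ this.ne'
  have hstep : ∀ n, l (n + 1) - l n = Real.log (1 + qf β (y (n + 1))) := by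
    intro n
    have h1 := qf_pos (β := β) (hy (n+1)).1 (hy (n+1)).2
    simp only [l]
    rw [← hr n]
    unfold T1
    rw [Real.log_mul (hy (n+1)).1.ne' (by linarith)]
    ring
  have hsplit : ∀ n, (l n) ^ (1 / γ) = l n * (l n) ^ β := by
    intro n
    rw [show 1 / γ = 1 + β by ring, Real.rpow_add (hl0 n), Real.rpow_one]
  have hlow : ∀ n, c / 2 ≤ (l (n + 1)) ^ (1 / γ) - (l n) ^ (1 / γ) := by
    intro n
    have q0 := qf_pos (β := β) (hy (n+1)).1 (hy (n+1)).2
    have q1 := qf_le_one hβ (hy (n+1)).1 (hy (n+1)).2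
    have h1 : qf β (y (n + 1)) / 2 ≤ l (n + 1) - l n := by
      rw [hstep]
      have := Real.one_sub_inv_le_log_of_pos (show 0 < 1 + qf β (y (n + 1)) by linarith)
      refine le_trans ?_ this
      have e : 1 - (1 + qf β (y (n + 1)))⁻¹ = qf β (y (n + 1)) / (1 + qf β (y (n + 1))) := by
        field_simp; ring
      rw [e]
      gcongr
      linarith
    have h2 : (l n) ^ β ≤ (l (n + 1)) ^ β := Real.rpow_le_rpow (hl0 n).le (by linarith) hβ
    have h3 := hq (n + 1)
    have h4 : 0 < (l (n + 1)) ^ β := Real.rpow_pos_of_pos (hl0 _) _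
    rw [hsplit, hsplit]
    nlinarith [hl0 n, mul_le_mul_of_nonneg_right h1 h4.le, mul_le_mul_of_nonneg_left h2 (hl0 n).le]
  have hup : ∀ n, (l (n + 1)) ^ (1 / γ) - (l n) ^ (1 / γ) ≤ (1 / γ) * c := by
    intro n
    have q0 := qf_pos (β := β) (hy (n+1)).1 (hy (n+1)).2
    have h1 : l (n + 1) - l n ≤ qf β (y (n + 1)) := by
      rw [hstep]
      linarith [Real.log_le_sub_one_of_pos (show 0 < 1 + qf β (y (n + 1)) by linarith)]
    have hb := hl0 (n + 1)
    have ha := hl0 n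
    have B := one_add_mul_self_le_rpow_one_add (s := l n / l (n+1) - 1)
      (by linarith [div_pos ha hb]) hp1
    rw [add_sub_cancel, Real.div_rpow ha.le hb.le, le_div_iff₀ (by positivity)] at B
    have h4 : 0 < (l (n + 1)) ^ β := Real.rpow_pos_of_pos (hl0 _) _
    have e : (1 + 1 / γ * (l n / l (n+1) - 1)) * l (n+1) ^ (1 / γ) =
        l (n+1) ^ (1 / γ) - 1 / γ * ((l (n+1) - l n) * l (n+1) ^ β) := by
      rw [hsplit]; field_simp; ring
    rw [e] at B
    have h5 : (l (n+1) - l n) * l (n+1) ^ β ≤ c := by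
      rw [← hq (n+1)]; gcongr
    have : 1 / γ * ((l (n+1) - l n) * l (n+1) ^ β) ≤ 1 / γ * c := by gcongr
    linarith
  have hL : ∀ n : ℕ, c / 2 * n ≤ (l n) ^ (1 / γ) := by
    intro n
    induction n with
    | zero => simp; exact Real.rpow_nonneg (hl0 0).le _
    | succ n ih => push_cast; linarith [hlow n]
  set D := (l 0) ^ (1 / γ) with hD
  have D0 : 0 < D := Real.rpow_pos_of_pos (hl0 0) _
  have hU : ∀ n : ℕ, (l n) ^ (1 / γ) ≤ D + (1 / γ) * c * n := by
    intro n
    induction n with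
    | zero => simp [hD]
    | succ n ih => push_cast; linarith [hup n]
  have hback : ∀ n, ((l n) ^ (1 / γ)) ^ γ = l n := by
    intro n
    rw [← Real.rpow_mul (hl0 n).le, one_div_mul_cancel hγ0.ne', Real.rpow_one]
  refine ⟨(c / 2) ^ γ, (D + 1 / γ * c) ^ γ, by positivity, by positivity, ?_⟩
  intro n hn
  have hn' : (1:ℝ) ≤ n := by exact_mod_cast hn
  have ey : y n = Real.exp (- l n) := by simp [l, Real.exp_log (hy n).1]
  rw [ey, Real.exp_le_exp, Real.exp_le_exp, neg_mul, neg_mul, neg_le_neg_iff, neg_le_neg_iff,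
    ← Real.mul_rpow (by positivity) (by positivity), ← Real.mul_rpow (by positivity) (by positivity),
    ← hback n]
  constructor
  · apply Real.rpow_le_rpow (Real.rpow_nonneg (hl0 n).le _) _ hγ0.le
    have := hU n
    nlinarith
  · exact Real.rpow_le_rpow (by positivity) (hL n) hγ0.le

/-- telescoping comparison -/
lemma sqrt_tel {γ : ℝ} (hγ0 : 0 < γ) (hγ1 : γ ≤ 1) : ∃ C : ℝ, 0 < C ∧
    ∀ u v : ℝ, 0 < u → u ≤ 1 / 2 → T1 (1 / γ - 1) u = v →
      v ≤ C * (Real.sqrt v - Real.sqrt u) := by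
  set β := 1 / γ - 1 with hβd
  have hp1 : 1 ≤ 1 / γ := by rw [le_div_iff₀ hγ0]; linarith
  have hβ : 0 ≤ β := by linarith
  have l2 := log2_pos
  set c := (Real.log 2) ^ β with hc
  have c0 : 0 < c := by positivity
  set d := (γ / 2) ^ β with hd
  have d0 : 0 < d := by positivity
  -- c * d * sqrt u ≤ q u
  have key : ∀ u : ℝ, 0 < u → u ≤ 1 / 2 → c * d * Real.sqrt u ≤ qf β u := by
    intro u h0 h1
    have hl : 0 < - Real.log u := l2.trans_le (log2_le h0 h1)
    have e1 : - Real.log u ≤ u⁻¹ ^ (γ / 2) / (γ / 2) := by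
      rw [← Real.log_inv]
      exact Real.log_le_rpow_div (by positivity) (by positivity)
    have e2 : (- Real.log u) ^ β ≤ (u⁻¹ ^ (γ / 2) / (γ / 2)) ^ β :=
      Real.rpow_le_rpow hl.le e1 hβ
    have e3 : (u⁻¹ ^ (γ / 2) / (γ / 2)) ^ β = u⁻¹ ^ (γ / 2 * β) / d := by
      rw [Real.div_rpow (by positivity) (by positivity), ← Real.rpow_mul (by positivity)]
    have e4 : u⁻¹ ^ (γ / 2 * β) ≤ u⁻¹ ^ (1 / 2 : ℝ) := by
      apply Real.rpow_le_rpow_of_exponent_le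
      · rw [one_le_inv₀ h0]; linarith
      · have : γ / 2 * β = 1 / 2 - γ / 2 := by rw [hβd]; field_simp
        linarith
    rw [← Real.sqrt_eq_rpow, Real.sqrt_inv] at e4
    have s0 : 0 < Real.sqrt u := Real.sqrt_pos.2 h0
    have e5 : (- Real.log u) ^ β ≤ (Real.sqrt u)⁻¹ / d := by
      rw [e3] at e2
      exact e2.trans (by gcongr)
    unfold qf
    rw [abs_log h0 (by linarith), ← hc, le_div_iff₀ (by positivity)]
    calc c * d * Real.sqrt u * (- Real.log u) ^ β
        ≤ c * d * Real.sqrt u * ((Real.sqrt u)⁻¹ / d) := by gcongr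
      _ = c := by field_simp
  refine ⟨6 / (c * d), by positivity, ?_⟩
  intro u v h0 h1 hv
  have k := key u h0 h1
  have q1 := qf_le_one hβ h0 h1
  have q0 := qf_pos (β := β) h0 h1
  unfold T1 at hv
  have hv2 : v ≤ 2 * u := by nlinarith
  have huv : u < v := by nlinarith
  set s := Real.sqrt u with hs
  set t := Real.sqrt v with ht
  have s0 : 0 < s := Real.sqrt_pos.2 h0
  have t0 : 0 < t := Real.sqrt_pos.2 (h0.trans huv)
  have s2 : s * s = u := Real.mul_self_sqrt h0.le
  have t2 : t * t = v := Real.mul_self_sqrt (h0.trans huv).le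
  have t3 : t ≤ 2 * s := by nlinarith
  -- (t - s)(t+s) = u q ≥ c d s^3
  have st : s < t := Real.sqrt_lt_sqrt h0.le huv
  have f1 : (t - s) * (t + s) = u * qf β u := by nlinarith
  have f2 : c * d * s * u ≤ (t - s) * (3 * s) := by nlinarith
  have f3 : c * d * u ≤ 3 * (t - s) := by
    by_contra! hcon
    nlinarith
  rw [div_mul_eq_mul_div, le_div_iff₀ (by positivity)]
  have : c * d * v ≤ c * d * (2 * u) := by gcongr
  linarith

/-- If `ν` is the (unique) `T`-invariant Borel probability measure on `[0,1]` absolutely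
continuous w.r.t. Lebesgue, and `y_0 = 1/2`, `y_{n+1} ∈ (0, 1/2]` with `T(y_{n+1}) = y_n`,
then there are `K, L, υ3, υ4 > 0` with
`L e^{-υ3 n^γ} ≤ ν((0, y_n]) ≤ K e^{-υ4 n^γ}` for all `n ≥ 1`. -/
theorem stmt5 (γ : ℝ) (hγ0 : 0 < γ) (hγ1 : γ ≤ 1)
    (ν : Measure ℝ) [IsProbabilityMeasure ν]
    (hsupp : ν (Set.Icc (0 : ℝ) 1)ᶜ = 0) (hac : ν ≪ volume)
    (hinv : ∀ A : Set ℝ, MeasurableSet A → ν (Tmap γ ⁻¹' A) = ν A)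
    (y : ℕ → ℝ) (hy0 : y 0 = 1 / 2)
    (hrec : ∀ n : ℕ, y (n + 1) ∈ Set.Ioc (0 : ℝ) (1 / 2) ∧ Tmap γ (y (n + 1)) = y n) :
    ∃ K L υ3 υ4 : ℝ, 0 < K ∧ 0 < L ∧ 0 < υ3 ∧ 0 < υ4 ∧
      ∀ n : ℕ, 1 ≤ n →
        ENNReal.ofReal (L * Real.exp (-υ3 * (n : ℝ) ^ γ)) ≤ ν (Set.Ioc 0 (y n)) ∧
        ν (Set.Ioc 0 (y n)) ≤ ENNReal.ofReal (K * Real.exp (-υ4 * (n : ℝ) ^ γ)) := by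
  have hp1 : 1 ≤ 1 / γ := by rw [le_div_iff₀ hγ0]; linarith
  have hβ : 0 ≤ 1 / γ - 1 := by linarith
  have hT1 : ∀ u, 0 < u → u ≤ 1 / 2 → Tmap γ u = T1 (1 / γ - 1) u := by
    intro u h0 h1
    unfold Tmap T1 qf
    rw [if_neg (not_le.2 h0), if_pos h1]
  have hy : ∀ n, 0 < y n ∧ y n ≤ 1 / 2 := by
    intro n
    cases n with
    | zero => rw [hy0]; norm_num
    | succ n => exact (hrec n).1
  have hr : ∀ n, T1 (1 / γ - 1) (y (n + 1)) = y n := by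
    intro n
    rw [← hT1 _ (hy _).1 (hy _).2]
    exact (hrec n).2
  obtain ⟨p, hp⟩ := exists_inv hβ
  obtain ⟨pc, pm, pmaps, pz, po, pexp⟩ := inv_props hβ hp
  have sm := T1_strictMono hβ
  let G : ℝ → ℝ := fun x => ν.real (Ioc 0 x)
  have hpre : ∀ x ∈ Icc (0:ℝ) 1,
      Tmap γ ⁻¹' (Ioc 0 x) = Ioc 0 (p x) ∪ Ioc (1 / 2) ((1 + x) / 2) := by
    intro x hx
    obtain ⟨hpx, hpe⟩ := hp x hx
    ext u
    simp only [mem_preimage, mem_union, mem_Ioc]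
    by_cases h0 : u ≤ 0
    · have : Tmap γ u = 0 := by unfold Tmap; rw [if_pos h0]
      rw [this]
      constructor
      · rintro ⟨h, _⟩; exact absurd h (lt_irrefl _)
      · rintro (⟨h, _⟩ | ⟨h, _⟩) <;> linarith
    · push Not at h0
      by_cases h1 : u ≤ 1 / 2
      · rw [hT1 u h0 h1]
        have hu : u ∈ Icc (0:ℝ) (1 / 2) := ⟨h0.le, h1⟩
        have pos : 0 < T1 (1 / γ - 1) u := by
          rw [← T1_zero (β := 1 / γ - 1)]
          exact sm ⟨le_rfl, by norm_num⟩ hu h0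
        have iff1 := sm.le_iff_le hu hpx
        rw [hpe] at iff1
        constructor
        · rintro ⟨_, h⟩; exact Or.inl ⟨h0, iff1.1 h⟩
        · rintro (⟨_, h⟩ | ⟨h, _⟩)
          · exact ⟨pos, iff1.2 h⟩
          · linarith
      · have : Tmap γ u = 2 * u - 1 := by
          unfold Tmap; rw [if_neg (not_le.2 h0), if_neg h1]
        push Not at h1
        rw [this]
        constructor
        · rintro ⟨_, h⟩; exact Or.inr ⟨h1, by linarith⟩
        · rintro (⟨_, h⟩ | ⟨_, h⟩)
          · linarith [hpx.2]
          · exact ⟨by linarith, by linarith⟩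
  have hGdiff : ∀ a b, 0 ≤ a → a ≤ b → ν.real (Ioc a b) = G b - G a := by
    intro a b ha hab
    have : Ioc (0:ℝ) b = Ioc 0 a ∪ Ioc a b := (Ioc_union_Ioc_eq_Ioc ha hab).symm
    simp only [G]
    rw [this, measureReal_union (Ioc_disjoint_Ioc_of_le le_rfl) measurableSet_Ioc]
    ring
  have hG : ∀ x ∈ Icc (0:ℝ) 1, G x = (G (p x)) + (G ((1 + x) / 2) - G (1 / 2)) := by
    intro x hx
    have e := hinv (Ioc 0 x) measurableSet_Ioc
    have e' : G x = ν.real (Tmap γ ⁻¹' (Ioc 0 x)) := by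
      simp only [G, measureReal_def]; rw [e]
    rw [e', hpre x hx, measureReal_union
      (Ioc_disjoint_Ioc_of_le (hp x hx).1.2) measurableSet_Ioc,
      hGdiff (1 / 2) ((1 + x) / 2) (by norm_num) (by linarith [hx.1])]
  have hG0 : G 0 = 0 := by simp [G]
  have hG1 : G 1 = 1 := by
    have h1 : ν (Icc (0:ℝ) 1) = 1 := by
      rw [← prob_compl_eq_zero_iff measurableSet_Icc]; exact hsupp
    have h2 : ν {(0:ℝ)} = 0 := hac (by simp)
    have h3 : ν (Ioc (0:ℝ) 1) = 1 := by
      rw [← h1, ← Icc_sdiff_left]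
      exact (measure_sdiff_null h2).symm ▸ rfl
    simp [G, measureReal_def, h3]
  have hconc : ConcaveOn ℝ (Icc 0 1) G := by
    refine concave_of_inv (h := fun x => (ν.rnDeriv volume x).toReal) pc pm pmaps pz po pexp hG hG0
      Measure.integrable_toReal_rnDeriv (fun x => ENNReal.toReal_nonneg) ?_
    intro x hx
    rw [intervalIntegral.integral_of_le hx.1, Measure.setIntegral_toReal_rnDeriv hac]
  have hGle : ∀ x, G x ≤ 1 := fun x => measureReal_le_one
  have hlower : ∀ x ∈ Icc (0:ℝ) 1, x ≤ G x := by
    intro x hx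
    have := hconc.2 (show (0:ℝ) ∈ Icc (0:ℝ) 1 by simp) (show (1:ℝ) ∈ Icc (0:ℝ) 1 by simp)
      (show 0 ≤ 1 - x by linarith [hx.2]) hx.1 (by ring)
    simpa [hG0, hG1] using this
  have hupper : ∀ t, 0 < t → t ≤ 1 → G ((1 + t) / 2) - G (1 / 2) ≤ t := by
    intro t h0 h1
    have := hconc.2 (show (0:ℝ) ∈ Icc (0:ℝ) 1 by simp)
      (show (1 + t) / 2 ∈ Icc (0:ℝ) 1 by constructor <;> linarith)
      (show 0 ≤ t / (1 + t) by positivity) (show 0 ≤ 1 / (1 + t) by positivity) (by field_simp; ring)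
    simp only [smul_eq_mul, hG0, mul_zero, zero_add] at this
    have e : 1 / (1 + t) * ((1 + t) / 2) = 1 / 2 := by field_simp
    rw [e, div_mul_eq_mul_div, one_mul, div_le_iff₀ (by linarith)] at this
    nlinarith [hGle (1 / 2)]
  obtain ⟨a, b, ha, hb, hab⟩ := seq_bounds hγ0 hγ1 hy hr
  obtain ⟨C, hC, hsq⟩ := sqrt_tel hγ0 hγ1
  have hyI : ∀ n, y n ∈ Icc (0:ℝ) 1 := fun n => ⟨(hy n).1.le, by linarith [(hy n).2]⟩
  have hpy : ∀ n, p (y n) = y (n + 1) := by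
    intro n
    obtain ⟨h1, h2⟩ := hp _ (hyI n)
    exact sm.injOn h1 ⟨(hy _).1.le, (hy _).2⟩ (by rw [h2, hr])
  have hylim : Filter.Tendsto y Filter.atTop (nhds 0) := by
    have h1 : Filter.Tendsto (fun n : ℕ => Real.exp (-a * (n:ℝ) ^ γ)) Filter.atTop (nhds 0) := by
      apply Real.tendsto_exp_atBot.comp
      have := ((tendsto_rpow_atTop hγ0).comp tendsto_natCast_atTop_atTop).const_mul_atTop_of_neg
        (show -a < 0 by linarith)
      exact this
    refine tendsto_of_tendsto_of_tendsto_of_le_of_le' tendsto_const_nhds h1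
      (Filter.Eventually.of_forall fun n => (hy n).1.le) ?_
    filter_upwards [Filter.eventually_ge_atTop 1] with n hn using (hab n hn).2
  have hyanti : Antitone y := by
    refine antitone_nat_of_succ_le fun n => ?_
    have q0 := qf_pos (β := 1 / γ - 1) (hy (n+1)).1 (hy (n+1)).2
    have := hr n
    unfold T1 at this
    nlinarith [(hy (n+1)).1]
  have hGlim : Filter.Tendsto (fun n => G (y n)) Filter.atTop (nhds 0) := by
    have h1 : Filter.Tendsto (fun n => ν (Ioc 0 (y n))) Filter.atTop
        (nhds (ν (⋂ n, Ioc 0 (y n)))) :=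
      tendsto_measure_iInter_atTop (fun n => measurableSet_Ioc.nullMeasurableSet)
        (fun m n hmn => Ioc_subset_Ioc_right (hyanti hmn)) ⟨0, measure_ne_top _ _⟩
    have h2 : (⋂ n, Ioc 0 (y n)) = (∅ : Set ℝ) := by
      ext u
      simp only [mem_iInter, mem_Ioc, mem_empty_iff_false, iff_false]
      intro hu
      have := ge_of_tendsto' hylim fun n => (hu n).2
      linarith [(hu 0).1]
    rw [h2, measure_empty] at h1
    have := (ENNReal.tendsto_toReal ENNReal.zero_ne_top).comp h1
    simpa [G, measureReal_def, Function.comp_def] using this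
  have hmono : Monotone fun n => G (y n) - C * Real.sqrt (y n) := by
    refine monotone_nat_of_le_succ fun n => ?_
    have h1 := hG _ (hyI n)
    rw [hpy] at h1
    have h2 := hupper (y n) (hy n).1 (hyI n).2
    have h3 := hsq (y (n + 1)) (y n) (hy _).1 (hy _).2 (hr n)
    linarith
  have hfin : ∀ n, G (y n) ≤ C * Real.sqrt (y n) := by
    intro n
    have hlim : Filter.Tendsto (fun n => G (y n) - C * Real.sqrt (y n)) Filter.atTop (nhds 0) := by
      have := hGlim.sub (((Real.continuous_sqrt.tendsto 0).comp hylim).const_mul C)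
      simpa [Function.comp_def] using this
    have := hmono.ge_of_tendsto hlim n
    linarith
  refine ⟨C, 1, b, a / 2, hC, one_pos, hb, by linarith, fun n hn => ?_⟩
  have hGν : ν (Ioc 0 (y n)) = ENNReal.ofReal (G (y n)) := by
    simp [G]
  rw [hGν]
  constructor
  · apply ENNReal.ofReal_le_ofReal
    rw [one_mul]
    exact (hab n hn).1.trans (hlower _ (hyI n))
  · apply ENNReal.ofReal_le_ofReal
    refine (hfin n).trans ?_
    gcongr
    rw [Real.sqrt_le_iff]
    refine ⟨(Real.exp_pos _).le, ?_⟩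
    rw [← Real.exp_nat_mul]
    refine (hab n hn).2.trans (le_of_eq ?_)
    congr 1
    push_cast
    ring
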